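/- For every real x with 0 < x < 27/4, (√3/(4π·x^{2/3}))·F₁(4x/27) + (1/(2π√3·x^{1/3}))·F₂(4x/27) = (√3/(2^{10/3}·π·x^{2/3}))·(3√(1−4x/27) − 1)·(1+√(1−4x/27))^{1/3} + (1/(2^{8/3}·π·x^{1/3}·√3))·(3√(1−4x/27) + 1)·(1+√(1−4x/27))^{−1/3}, where F₁(u) = Σ_{n≥0} [(−2/3)ₙ(5/6)ₙ/((2/3)ₙ n!)]·uⁿ and F₂(u) = Σ_{n≥0} [(−1/3)ₙ(7/6)ₙ/((4/3)ₙ n!)]·uⁿ. -/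

import Mathlib

/-- The rising Pochhammer symbol `(a)ₙ = a(a+1)⋯(a+n−1)`. -/
noncomputable def poch (a : ℝ) (n : ℕ) : ℝ := ∏ i ∈ Finset.range n, (a + i)

/-- The Gauss hypergeometric series `₂F₁(−2/3, 5/6; 2/3 | u)`. -/
noncomputable def F₁ (u : ℝ) : ℝ :=
  ∑' n : ℕ, poch (-2 / 3) n * poch (5 / 6) n / (poch (2 / 3) n * n.factorial) * u ^ n

/-- The Gauss hypergeometric series `₂F₁(−1/3, 7/6; 4/3 | u)`. -/
noncomputable def F₂ (u : ℝ) : ℝ :=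
  ∑' n : ℕ, poch (-1 / 3) n * poch (7 / 6) n / (poch (4 / 3) n * n.factorial) * u ^ n

lemma hsc {f g : ℕ → ℝ} {a : ℝ} (h : ∀ n, f n = g n) : HasSum f a ↔ HasSum g a := by
  rw [funext h]

lemma ps_deriv (a : ℕ → ℝ) (C : ℝ) (k : ℕ) (ha : ∀ n, |a n| ≤ C * ((n:ℝ) + 1) ^ k) :
    (∀ u : ℝ, |u| < 1 → HasSum (fun n => a n * u ^ n) (∑' n, a n * u ^ n)) := by
  intro u hu
  apply Summable.hasSum
  have h1 : Summable (fun n : ℕ => ((n:ℝ)) ^ k * |u| ^ n) :=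
    summable_pow_mul_geometric_of_norm_lt_one k (by simpa using hu)
  have h0 : Summable (fun n : ℕ => |u| ^ n) :=
    summable_geometric_of_lt_one (abs_nonneg u) hu
  have hC : 0 ≤ C := by
    have := (abs_nonneg _).trans (ha 0)
    simpa using this
  refine Summable.of_norm_bounded ((h1.add h0).mul_left (C * 2 ^ k)) ?_
  intro n
  rw [Real.norm_eq_abs, abs_mul, abs_pow]
  have hb : ((n:ℝ) + 1) ^ k ≤ 2 ^ k * ((n:ℝ) ^ k + 1) := by
    rcases Nat.eq_zero_or_pos n with h | h
    · subst h
      have : (1:ℝ) ≤ 2 ^ k := one_le_pow₀ (by norm_num)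
      have h2 : (0:ℝ) ≤ 0 ^ k := by positivity
      simp only [Nat.cast_zero, zero_add, one_pow]
      nlinarith
    · have h' : (1:ℝ) ≤ n := by exact_mod_cast h
      calc ((n:ℝ) + 1) ^ k ≤ (2 * n) ^ k := by gcongr; linarith
        _ = 2 ^ k * (n:ℝ) ^ k := mul_pow _ _ _
        _ ≤ _ := by gcongr; linarith
  calc |a n| * |u| ^ n ≤ (C * (2 ^ k * ((n:ℝ) ^ k + 1))) * |u| ^ n := by
        gcongr
        exact (ha n).trans (by gcongr)
    _ = _ := by ring

lemma ps_bd (a : ℕ → ℝ) (C : ℝ) (k : ℕ) (ha : ∀ n, |a n| ≤ C * ((n:ℝ) + 1) ^ k) :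
    ∀ n, |(fun n : ℕ => ((n:ℝ) + 1) * a (n + 1)) n| ≤ (C * 2 ^ k) * ((n:ℝ) + 1) ^ (k + 1) := by
  intro n
  have hC : 0 ≤ C := by
    have := (abs_nonneg _).trans (ha 0)
    simpa using this
  have h := ha (n + 1)
  push_cast at h
  simp only
  rw [abs_mul, abs_of_nonneg (by positivity : (0:ℝ) ≤ (n:ℝ) + 1)]
  calc ((n:ℝ) + 1) * |a (n + 1)| ≤ ((n:ℝ) + 1) * (C * ((n:ℝ) + 1 + 1) ^ k) := by gcongr
    _ ≤ ((n:ℝ) + 1) * (C * (2 * ((n:ℝ) + 1)) ^ k) := by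
        gcongr
        have : (0:ℝ) ≤ n := by positivity
        linarith
    _ = _ := by rw [mul_pow]; ring

lemma ps_hasDeriv (a : ℕ → ℝ) (C : ℝ) (k : ℕ) (ha : ∀ n, |a n| ≤ C * ((n:ℝ) + 1) ^ k)
    (u : ℝ) (hu : |u| < 1) :
    HasDerivAt (fun u : ℝ => ∑' n, a n * u ^ n) (∑' n : ℕ, (((n:ℝ) + 1) * a (n + 1)) * u ^ n) u := by
  obtain ⟨r, hr1, hr2⟩ := exists_between hu
  have hr0 : 0 ≤ r := (abs_nonneg u).trans hr1.le
  have hbd := ps_bd a C k ha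
  have hs : ∀ v : ℝ, |v| < 1 → HasSum (fun n : ℕ => a n * (n * v ^ (n - 1)))
      (∑' n : ℕ, (((n:ℝ) + 1) * a (n + 1)) * v ^ n) := by
    intro v hv
    have h2 := ps_deriv _ _ _ hbd v hv
    rw [← hasSum_nat_add_iff' 1]
    simp only [Finset.range_one, Finset.sum_singleton, Nat.cast_zero, zero_mul, mul_zero, sub_zero]
    refine (hsc fun n => ?_).mpr h2
    simp only [Nat.add_sub_cancel, Nat.cast_add, Nat.cast_one]
    ring
  have hs' : Summable (fun n : ℕ => |a n| * (n * r ^ (n - 1))) := by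
    have := ((hs r (by rwa [abs_of_nonneg hr0])).summable).abs
    refine this.congr fun n => ?_
    rw [abs_mul, abs_of_nonneg (by positivity : (0:ℝ) ≤ n * r ^ (n - 1))]
  have key := hasDerivAt_tsum_of_isPreconnected (g := fun n (u:ℝ) => a n * u ^ n)
    (g' := fun n (u:ℝ) => a n * (n * u ^ (n - 1))) (t := Metric.ball 0 r) (y₀ := 0) (y := u)
    hs' Metric.isOpen_ball (convex_ball _ _).isPreconnected
    (fun n y _ => (hasDerivAt_pow n y).const_mul (a n))
    (fun n y hy => by
      have hy' : |y| ≤ r := by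
        have := Metric.mem_ball.1 hy
        rw [dist_zero_right, Real.norm_eq_abs] at this
        exact this.le
      rw [Real.norm_eq_abs, abs_mul, abs_mul, abs_pow, Nat.abs_cast]
      gcongr)
    (by simpa using (abs_nonneg u).trans_lt hr1)
    ((ps_deriv a C k ha 0 (by simp)).summable)
    (by simpa using hr1)
  rw [(hs u hu).tsum_eq] at key
  exact key

/-- hypergeometric ODE package -/
lemma hyp_ode (a : ℕ → ℝ) (A B c : ℝ) (ha : ∀ n, |a n| ≤ 1)
    (hrec : ∀ n : ℕ, ((n:ℝ) + 1) * (n + c) * a (n + 1) = (n + A) * (n + B) * a n) :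
    ∃ D E : ℝ → ℝ, ∀ u : ℝ, |u| < 1 →
      HasDerivAt (fun u : ℝ => ∑' n, a n * u ^ n) (D u) u ∧ HasDerivAt D (E u) u ∧
      u * (1 - u) * E u + (c - (A + B + 1) * u) * D u - A * B * (∑' n, a n * u ^ n) = 0 := by
  have b0 : ∀ n, |a n| ≤ 1 * ((n:ℝ) + 1) ^ 0 := by simpa using ha
  have b1 := ps_bd _ _ _ b0
  have b2 := ps_bd _ _ _ b1
  refine ⟨_, _, fun u hu => ⟨ps_hasDeriv _ _ _ b0 u hu, ps_hasDeriv _ _ _ b1 u hu, ?_⟩⟩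
  have s0 := ps_deriv _ _ _ b0 u hu
  have s1 := ps_deriv _ _ _ b1 u hu
  have s2 := ps_deriv _ _ _ b2 u hu
  set F := ∑' n, a n * u ^ n
  set D := ∑' n : ℕ, (((n:ℝ) + 1) * a (n + 1)) * u ^ n
  set E := ∑' n : ℕ, ((n:ℝ) + 1) * (((n + 1 : ℕ) : ℝ) + 1) * a (n + 1 + 1) * u ^ n with hE
  have s1' : HasSum (fun n : ℕ => (n:ℝ) * a n * u ^ n) (u * D) := by
    rw [← hasSum_nat_add_iff' 1]
    simp only [Finset.range_one, Finset.sum_singleton, Nat.cast_zero, zero_mul, sub_zero]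
    refine (hsc fun n => ?_).mpr (s1.mul_left u)
    push_cast
    ring
  have s2' : HasSum (fun n : ℕ => (n:ℝ) * (n + 1) * a (n + 1) * u ^ n)
      (u * ∑' n : ℕ, ((n:ℝ) + 1) * ((((n + 1 : ℕ) : ℝ) + 1) * a (n + 1 + 1)) * u ^ n) := by
    rw [← hasSum_nat_add_iff' 1]
    simp only [Finset.range_one, Finset.sum_singleton, Nat.cast_zero, zero_mul, sub_zero]
    refine (hsc fun n => ?_).mpr (s2.mul_left u)
    push_cast
    ring
  have s2'' : HasSum (fun n : ℕ => (n:ℝ) * (n - 1) * a n * u ^ n)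
      (u * (u * ∑' n : ℕ, ((n:ℝ) + 1) * ((((n + 1 : ℕ) : ℝ) + 1) * a (n + 1 + 1)) * u ^ n)) := by
    rw [← hasSum_nat_add_iff' 1]
    simp only [Finset.range_one, Finset.sum_singleton, Nat.cast_zero, zero_mul, sub_zero]
    refine (hsc fun n => ?_).mpr (s2'.mul_left u)
    push_cast
    ring
  have tot := (((s2'.sub s2'').add (s1.mul_left c)).sub (s1'.mul_left (A + B + 1))).sub
    (s0.mul_left (A * B))
  have hz : HasSum (fun _ : ℕ => (0:ℝ)) 0 := hasSum_zero
  have := tot.unique (hz.congr_fun ?_) 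
  · linear_combination this
  · intro n
    linear_combination (u ^ n) * hrec n

lemma poch_succ (a : ℝ) (n : ℕ) : poch a (n + 1) = poch a n * (a + n) := by
  simp [poch, Finset.prod_range_succ]

lemma poch_pos (a : ℝ) (ha : 0 < a) (n : ℕ) : 0 < poch a n :=
  Finset.prod_pos fun i _ => by positivity

noncomputable def cf (A B c : ℝ) (n : ℕ) : ℝ := poch A n * poch B n / (poch c n * n.factorial)

lemma cf_rec (A B c : ℝ) (hc : 0 < c) (n : ℕ) :
    ((n:ℝ) + 1) * (n + c) * cf A B c (n + 1) = (n + A) * (n + B) * cf A B c n := by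
  have h1 := (poch_pos c hc n).ne'
  have h2 : (n.factorial : ℝ) ≠ 0 := by positivity
  have h3 : c + n ≠ 0 := by positivity
  have h4 : (n:ℝ) + 1 ≠ 0 := by positivity
  simp only [cf, poch_succ, Nat.factorial_succ]
  push_cast
  field_simp
  ring

lemma cf_bd (A B c : ℝ) (hc : 0 < c) (h : ∀ n : ℕ, |((n:ℝ) + A) * (n + B)| ≤ ((n:ℝ) + 1) * (n + c))
    (n : ℕ) : |cf A B c n| ≤ 1 := by
  induction n with
  | zero => simp [cf, poch]
  | succ n ih =>
    have hr := congrArg abs (cf_rec A B c hc n)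
    have hp : 0 < ((n:ℝ) + 1) * (n + c) := by positivity
    rw [abs_mul, abs_mul (((n:ℝ) + A) * (n + B)), abs_of_pos hp] at hr
    have : |((n:ℝ) + A) * (n + B)| * |cf A B c n| ≤ ((n:ℝ) + 1) * (n + c) * 1 :=
      mul_le_mul (h n) ih (abs_nonneg _) hp.le
    rw [← hr] at this
    exact le_of_mul_le_mul_left this hp

lemma const_of (f f' : ℝ → ℝ) (s : ℝ) (hs : s < 1)
    (hc : ContinuousOn f (Set.Icc s 1)) (h : ∀ x ∈ Set.Ioo s 1, HasDerivAt f (f' x) x)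
    (h0 : ∀ x ∈ Set.Ioo s 1, f' x = 0) : f s = f 1 := by
  obtain ⟨c, hc1, hc2⟩ := exists_hasDerivAt_eq_slope f f' hs hc h
  rw [h0 c hc1, eq_comm, div_eq_zero_iff] at hc2
  rcases hc2 with h | h <;> linarith

lemma sq_dom {x s : ℝ} (hs0 : 0 < s) (hx : x ∈ Set.Icc s 1) : |1 - x ^ 2| < 1 := by
  rw [abs_lt]
  constructor <;> nlinarith [hx.1, hx.2]

lemma F1_eq (s : ℝ) (hs0 : 0 < s) (hs1 : s < 1) :
    F₁ (1 - s ^ 2) = (1 / 4) * 2 ^ ((2:ℝ) / 3) * (3 * s - 1) * (1 + s) ^ ((1:ℝ) / 3) := by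
  obtain ⟨D, E, h⟩ := hyp_ode (cf (-2/3) (5/6) (2/3)) (-2/3) (5/6) (2/3)
    (cf_bd _ _ _ (by norm_num) (fun n => by
      have : (0:ℝ) ≤ n := by positivity
      rw [abs_le]; constructor <;> nlinarith)) (cf_rec _ _ _ (by norm_num))
  change ∀ u : ℝ, |u| < 1 → HasDerivAt F₁ (D u) u ∧ _ ∧ _ * E u + _ * D u - _ * F₁ u = 0 at h
  have hF0 : F₁ 0 = 1 := by
    unfold F₁
    rw [tsum_eq_single 0]
    · simp [poch]
    · intro n hn; simp [hn]
  have hsq : ∀ x : ℝ, HasDerivAt (fun x : ℝ => 1 - x ^ 2) (-(2 * x)) x := fun x => by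
    simpa using (hasDerivAt_pow 2 x).const_sub 1
  have hFd : ∀ x ∈ Set.Icc s 1, HasDerivAt (fun x => F₁ (1 - x ^ 2)) (D (1 - x ^ 2) * (-(2 * x))) x :=
    fun x hx => by
      have h1 := (h _ (sq_dom hs0 hx)).1
      exact h1.comp x (hsq x)
  have hDd : ∀ x ∈ Set.Icc s 1, HasDerivAt (fun x => D (1 - x ^ 2)) (E (1 - x ^ 2) * (-(2 * x))) x :=
    fun x hx => (h _ (sq_dom hs0 hx)).2.1.comp x (hsq x)
  have hFc : ContinuousOn (fun x => F₁ (1 - x ^ 2)) (Set.Icc s 1) :=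
    fun x hx => (hFd x hx).continuousAt.continuousWithinAt
  have hDc : ContinuousOn (fun x => D (1 - x ^ 2)) (Set.Icc s 1) :=
    fun x hx => (hDd x hx).continuousAt.continuousWithinAt
  have I1 := const_of (fun x => (1 - x) ^ ((2:ℝ)/3) *
      (F₁ (1 - x ^ 2) * ((6 * x + 4) / 3) + D (1 - x ^ 2) * (x * (3 * x - 1) * (1 + x)))) _ s hs1
    (by
      refine ContinuousOn.mul ?_ ((hFc.mul (by fun_prop)).add (hDc.mul (by fun_prop)))
      exact ContinuousOn.rpow_const (by fun_prop) (fun x _ => Or.inr (by norm_num)))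
    (fun x hx => (((hasDerivAt_id x).const_sub 1).rpow_const (Or.inl (sub_pos.2 hx.2).ne')).mul
      (((hFd x (Set.Ioo_subset_Icc_self hx)).mul
        ((((hasDerivAt_id x).const_mul 6).add_const 4).div_const 3)).add
      ((hDd x (Set.Ioo_subset_Icc_self hx)).mul
        (((hasDerivAt_id x).mul (((hasDerivAt_id x).const_mul 3).sub_const 1)).mul
          ((hasDerivAt_id x).const_add 1)))))
    (fun x hx => by
      have hode := (h _ (sq_dom hs0 (Set.Ioo_subset_Icc_self hx))).2.2
      have hr : (1 - x) ^ ((2:ℝ)/3) = (1 - x) ^ ((2:ℝ)/3 - 1) * (1 - x) := by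
        rw [← Real.rpow_add_one (sub_pos.2 hx.2).ne']; norm_num
      simp only [id, Pi.mul_apply]
      rw [hr]
      linear_combination (-2 * (3 * x - 1)) * (1 - x) ^ ((2:ℝ)/3 - 1) * hode)
  have I2 := const_of (fun x => (1 + x) ^ ((2:ℝ)/3) *
      (F₁ (1 - x ^ 2) * ((4 - 6 * x) / 3) + D (1 - x ^ 2) * (x * (3 * x + 1) * (1 - x)))) _ s hs1
    (by
      refine ContinuousOn.mul ?_ ((hFc.mul (by fun_prop)).add (hDc.mul (by fun_prop)))
      exact ContinuousOn.rpow_const (by fun_prop) (fun x _ => Or.inr (by norm_num)))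
    (fun x hx => (((hasDerivAt_id x).const_add 1).rpow_const
        (Or.inl (add_pos one_pos (hs0.trans hx.1)).ne')).mul
      (((hFd x (Set.Ioo_subset_Icc_self hx)).mul
        ((((hasDerivAt_id x).const_mul 6).const_sub 4).div_const 3)).add
      ((hDd x (Set.Ioo_subset_Icc_self hx)).mul
        (((hasDerivAt_id x).mul (((hasDerivAt_id x).const_mul 3).add_const 1)).mul
          ((hasDerivAt_id x).const_sub 1)))))
    (fun x hx => by
      have hode := (h _ (sq_dom hs0 (Set.Ioo_subset_Icc_self hx))).2.2
      have hr : (1 + x) ^ ((2:ℝ)/3) = (1 + x) ^ ((2:ℝ)/3 - 1) * (1 + x) := by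
        rw [← Real.rpow_add_one (add_pos one_pos (hs0.trans hx.1)).ne']; norm_num
      simp only [id, Pi.mul_apply]
      rw [hr]
      linear_combination (-2 * (3 * x + 1)) * (1 + x) ^ ((2:ℝ)/3 - 1) * hode)
  rw [sub_self, Real.zero_rpow (by norm_num), zero_mul] at I1
  have hp : 0 < (1 - s) ^ ((2:ℝ)/3) := Real.rpow_pos_of_pos (by linarith) _
  have I1' := (mul_eq_zero.1 I1).resolve_left hp.ne'
  norm_num [hF0] at I2
  have hr : (1 + s) ^ ((2:ℝ)/3) * (1 + s) ^ ((1:ℝ)/3) = 1 + s := by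
    rw [← Real.rpow_add (by linarith)]; norm_num
  have hq : 0 < (1 + s) ^ ((2:ℝ)/3) := Real.rpow_pos_of_pos (by linarith) _
  apply mul_left_cancel₀ hq.ne'
  linear_combination (-3/8) * (3 * s - 1) * (1 + s) * I2 - (1 / 4) * 2 ^ ((2:ℝ)/3) * (3 * s - 1) * hr + (3/8) * (3 * s + 1) * (1 - s) * (1 + s) ^ ((2:ℝ)/3) * I1'

lemma F2_eq (s : ℝ) (hs0 : 0 < s) (hs1 : s < 1) :
    F₂ (1 - s ^ 2) = (1 / 8) * 2 ^ ((4:ℝ) / 3) * (3 * s + 1) * (1 + s) ^ (-(1:ℝ) / 3) := by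
  obtain ⟨D, E, h⟩ := hyp_ode (cf (-1/3) (7/6) (4/3)) (-1/3) (7/6) (4/3)
    (cf_bd _ _ _ (by norm_num) (fun n => by
      have : (0:ℝ) ≤ n := by positivity
      rw [abs_le]; constructor <;> nlinarith)) (cf_rec _ _ _ (by norm_num))
  change ∀ u : ℝ, |u| < 1 → HasDerivAt F₂ (D u) u ∧ _ ∧ _ * E u + _ * D u - _ * F₂ u = 0 at h
  have hF0 : F₂ 0 = 1 := by
    unfold F₂
    rw [tsum_eq_single 0]
    · simp [poch]
    · intro n hn; simp [hn]
  have hsq : ∀ x : ℝ, HasDerivAt (fun x : ℝ => 1 - x ^ 2) (-(2 * x)) x := fun x => by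
    simpa using (hasDerivAt_pow 2 x).const_sub 1
  have hFd : ∀ x ∈ Set.Icc s 1, HasDerivAt (fun x => F₂ (1 - x ^ 2)) (D (1 - x ^ 2) * (-(2 * x))) x :=
    fun x hx => by
      have h1 := (h _ (sq_dom hs0 hx)).1
      exact h1.comp x (hsq x)
  have hDd : ∀ x ∈ Set.Icc s 1, HasDerivAt (fun x => D (1 - x ^ 2)) (E (1 - x ^ 2) * (-(2 * x))) x :=
    fun x hx => (h _ (sq_dom hs0 hx)).2.1.comp x (hsq x)
  have hFc : ContinuousOn (fun x => F₂ (1 - x ^ 2)) (Set.Icc s 1) :=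
    fun x hx => (hFd x hx).continuousAt.continuousWithinAt
  have hDc : ContinuousOn (fun x => D (1 - x ^ 2)) (Set.Icc s 1) :=
    fun x hx => (hDd x hx).continuousAt.continuousWithinAt
  have I1 := const_of (fun x => (1 - x) ^ ((4:ℝ)/3) *
      (F₂ (1 - x ^ 2) * ((3 * x + 4) / 3) + D (1 - x ^ 2) * (x * (3 * x + 1) * (1 + x)))) _ s hs1
    (by
      refine ContinuousOn.mul ?_ ((hFc.mul (by fun_prop)).add (hDc.mul (by fun_prop)))
      exact ContinuousOn.rpow_const (by fun_prop) (fun x _ => Or.inr (by norm_num)))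
    (fun x hx => (((hasDerivAt_id x).const_sub 1).rpow_const (Or.inl (sub_pos.2 hx.2).ne')).mul
      (((hFd x (Set.Ioo_subset_Icc_self hx)).mul
        ((((hasDerivAt_id x).const_mul 3).add_const 4).div_const 3)).add
      ((hDd x (Set.Ioo_subset_Icc_self hx)).mul
        (((hasDerivAt_id x).mul (((hasDerivAt_id x).const_mul 3).add_const 1)).mul
          ((hasDerivAt_id x).const_add 1)))))
    (fun x hx => by
      have hode := (h _ (sq_dom hs0 (Set.Ioo_subset_Icc_self hx))).2.2
      have hr : (1 - x) ^ ((4:ℝ)/3) = (1 - x) ^ ((4:ℝ)/3 - 1) * (1 - x) := by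
        rw [← Real.rpow_add_one (sub_pos.2 hx.2).ne']; norm_num
      simp only [id, Pi.mul_apply]
      rw [hr]
      linear_combination (-2 * (3 * x + 1)) * (1 - x) ^ ((4:ℝ)/3 - 1) * hode)
  have I2 := const_of (fun x => (1 + x) ^ ((4:ℝ)/3) *
      (F₂ (1 - x ^ 2) * ((4 - 3 * x) / 3) + D (1 - x ^ 2) * (x * (3 * x - 1) * (1 - x)))) _ s hs1
    (by
      refine ContinuousOn.mul ?_ ((hFc.mul (by fun_prop)).add (hDc.mul (by fun_prop)))
      exact ContinuousOn.rpow_const (by fun_prop) (fun x _ => Or.inr (by norm_num)))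
    (fun x hx => (((hasDerivAt_id x).const_add 1).rpow_const
        (Or.inl (add_pos one_pos (hs0.trans hx.1)).ne')).mul
      (((hFd x (Set.Ioo_subset_Icc_self hx)).mul
        ((((hasDerivAt_id x).const_mul 3).const_sub 4).div_const 3)).add
      ((hDd x (Set.Ioo_subset_Icc_self hx)).mul
        (((hasDerivAt_id x).mul (((hasDerivAt_id x).const_mul 3).sub_const 1)).mul
          ((hasDerivAt_id x).const_sub 1)))))
    (fun x hx => by
      have hode := (h _ (sq_dom hs0 (Set.Ioo_subset_Icc_self hx))).2.2
      have hr : (1 + x) ^ ((4:ℝ)/3) = (1 + x) ^ ((4:ℝ)/3 - 1) * (1 + x) := by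
        rw [← Real.rpow_add_one (add_pos one_pos (hs0.trans hx.1)).ne']; norm_num
      simp only [id, Pi.mul_apply]
      rw [hr]
      linear_combination (-2 * (3 * x - 1)) * (1 + x) ^ ((4:ℝ)/3 - 1) * hode)
  rw [sub_self, Real.zero_rpow (by norm_num), zero_mul] at I1
  have hp : 0 < (1 - s) ^ ((4:ℝ)/3) := Real.rpow_pos_of_pos (by linarith) _
  have I1' := (mul_eq_zero.1 I1).resolve_left hp.ne'
  norm_num [hF0] at I2
  have hr : (1 + s) ^ ((4:ℝ)/3) * (1 + s) ^ (-(1:ℝ)/3) = 1 + s := by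
    rw [← Real.rpow_add (by linarith)]; norm_num
  have hq : 0 < (1 + s) ^ ((4:ℝ)/3) := Real.rpow_pos_of_pos (by linarith) _
  apply mul_left_cancel₀ hq.ne'
  linear_combination (3/8) * (3 * s + 1) * (1 + s) * I2 - (1 / 8) * 2 ^ ((4:ℝ)/3) * (3 * s + 1) * hr - (3/8) * (3 * s - 1) * (1 - s) * (1 + s) ^ ((4:ℝ)/3) * I1'

theorem stmt_13 (x : ℝ) (hx0 : 0 < x) (hx1 : x < 27 / 4) :
    Real.sqrt 3 / (4 * Real.pi * x ^ ((2 : ℝ) / 3)) * F₁ (4 * x / 27)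
      + 1 / (2 * Real.pi * Real.sqrt 3 * x ^ ((1 : ℝ) / 3)) * F₂ (4 * x / 27)
      = Real.sqrt 3 / ((2 : ℝ) ^ ((10 : ℝ) / 3) * Real.pi * x ^ ((2 : ℝ) / 3)) *
          (3 * Real.sqrt (1 - 4 * x / 27) - 1) *
          (1 + Real.sqrt (1 - 4 * x / 27)) ^ ((1 : ℝ) / 3)
        + 1 / ((2 : ℝ) ^ ((8 : ℝ) / 3) * Real.pi * x ^ ((1 : ℝ) / 3) * Real.sqrt 3) *
          (3 * Real.sqrt (1 - 4 * x / 27) + 1) *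
          (1 + Real.sqrt (1 - 4 * x / 27)) ^ (-(1 : ℝ) / 3) := by
  set s := Real.sqrt (1 - 4 * x / 27) with hs
  have hpos : 0 < 1 - 4 * x / 27 := by linarith
  have hs0 : 0 < s := Real.sqrt_pos.2 hpos
  have hsq : s ^ 2 = 1 - 4 * x / 27 := Real.sq_sqrt hpos.le
  have hs1 : s < 1 := by nlinarith
  have hu : 4 * x / 27 = 1 - s ^ 2 := by linarith
  rw [hu, F1_eq s hs0 hs1, F2_eq s hs0 hs1]
  have e1 : (2:ℝ) ^ ((10:ℝ)/3) * 2 ^ ((2:ℝ)/3) = 16 := by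
    rw [← Real.rpow_add (by norm_num)]; norm_num
  have e2 : (2:ℝ) ^ ((8:ℝ)/3) * 2 ^ ((4:ℝ)/3) = 16 := by
    rw [← Real.rpow_add (by norm_num)]; norm_num
  have p1 : 0 < (2:ℝ) ^ ((10:ℝ)/3) := by positivity
  have p2 : 0 < (2:ℝ) ^ ((8:ℝ)/3) := by positivity
  rw [(eq_div_iff p1.ne').2 ((mul_comm _ _).trans e1), (eq_div_iff p2.ne').2 ((mul_comm _ _).trans e2)]
  have q1 : x ^ ((2:ℝ)/3) ≠ 0 := (Real.rpow_pos_of_pos hx0 _).ne'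
  have q2 : x ^ ((1:ℝ)/3) ≠ 0 := (Real.rpow_pos_of_pos hx0 _).ne'
  have hpi := Real.pi_ne_zero
  have h3 : Real.sqrt 3 ≠ 0 := by positivity
  congr 1
  · generalize (2:ℝ) ^ ((10:ℝ)/3) = y at *
    have := p1.ne'
    field_simp
    norm_num
  · generalize (2:ℝ) ^ ((8:ℝ)/3) = y at *
    have := p2.ne'
    field_simp
    norm_num
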